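/- arXiv:2601.13340 — 3 statements merged into one kernel-verified Lean document; each statement's English description precedes it below -/
import Mathlib

section
/- For every natural number m, the matrices φ_m and ψ_m satisfy the matrix factorization identities φ_m · ψ_m = ψ_m · φ_m = q_m · I_{2^m}, where I_{2^m} is the identity matrix of size 2^m × 2^m and q_m · I_{2^m} denotes the scalar matrix with the polynomial q_m on the diagonal. -/
open MvPolynomial Matrix

/-- Langer's pair of matrices `(φ_m, ψ_m)` of size `2^m × 2^m` with entries in the
polynomial ring (variables indexed by `ℕ`, with `x_{i+1}` corresponding to `X i`),
defined inductively by `φ_0 = (x_1)`, `ψ_0 = (x_2)` and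
`φ_{m+1} = [[φ_m, x_{2m+3}·I],[x_{2m+4}·I, −ψ_m]]`,
`ψ_{m+1} = [[ψ_m, x_{2m+3}·I],[x_{2m+4}·I, −φ_m]]`. -/
noncomputable def langerPair (K : Type*) [Field K] :
    (m : ℕ) → Matrix (Fin (2 ^ m)) (Fin (2 ^ m)) (MvPolynomial ℕ K) ×
      Matrix (Fin (2 ^ m)) (Fin (2 ^ m)) (MvPolynomial ℕ K)
  | 0 => (Matrix.of fun _ _ => X 0, Matrix.of fun _ _ => X 1)
  | (m + 1) =>
    let φ := (langerPair K m).1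
    let ψ := (langerPair K m).2
    let e : Fin (2 ^ (m + 1)) ≃ Fin (2 ^ m) ⊕ Fin (2 ^ m) :=
      (finCongr (by rw [pow_succ]; ring)).trans finSumFinEquiv.symm
    ((Matrix.reindex e.symm e.symm)
        (Matrix.fromBlocks φ ((X (2 * m + 2) : MvPolynomial ℕ K) • 1) ((X (2 * m + 3) : MvPolynomial ℕ K) • 1) (-ψ)),
     (Matrix.reindex e.symm e.symm)
        (Matrix.fromBlocks ψ ((X (2 * m + 2) : MvPolynomial ℕ K) • 1) ((X (2 * m + 3) : MvPolynomial ℕ K) • 1) (-φ)))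

/-- The quadratic form `q_m = x_1x_2 + x_3x_4 + ⋯ + x_{2m+1}x_{2m+2}` (with `x_{i+1}`
corresponding to the variable `X i`). -/
noncomputable def langerQ (K : Type*) [Field K] (m : ℕ) : MvPolynomial ℕ K :=
  ∑ i ∈ Finset.range (m + 1), X (2 * i) * X (2 * i + 1)

theorem Matrix.fromBlocks_smul_one_mul_fromBlocks {n R : Type*} [Fintype n] [DecidableEq n]
    [CommRing R] {A B : Matrix n n R} {q : R} (a b : R) (hAB : A * B = q • 1)
    (hBA : B * A = q • 1) :
    fromBlocks A (a • 1) (b • 1) (-B) * fromBlocks B (a • 1) (b • 1) (-A) =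
      (q + a * b) • (1 : Matrix (n ⊕ n) (n ⊕ n) R) := by
  rw [fromBlocks_multiply, ← fromBlocks_one, fromBlocks_smul]
  simp [hAB, hBA, add_smul, smul_smul, mul_comm b a, add_comm (q • (1 : Matrix n n R))]

theorem langerQ_succ (K : Type*) [Field K] (m : ℕ) :
    langerQ K (m + 1) = langerQ K m + X (2 * m + 2) * X (2 * m + 3) := by
  simp only [langerQ, Finset.sum_range_succ _ (m + 1), mul_add, mul_one, add_assoc,
    Nat.reduceAdd]

/-- For every natural number `m`, Langer's matrices `φ_m` and `ψ_m` satisfy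
the matrix factorization identities `φ_m · ψ_m = ψ_m · φ_m = q_m · I_{2^m}`. -/
theorem langer_matrix_factorization (K : Type*) [Field K] (m : ℕ) :
    (langerPair K m).1 * (langerPair K m).2 =
      langerQ K m • (1 : Matrix (Fin (2 ^ m)) (Fin (2 ^ m)) (MvPolynomial ℕ K)) ∧
    (langerPair K m).2 * (langerPair K m).1 =
      langerQ K m • (1 : Matrix (Fin (2 ^ m)) (Fin (2 ^ m)) (MvPolynomial ℕ K)) := by
  induction m with
  | zero =>
    constructor <;> ext1 i j <;> obtain rfl : i = j := Fin.subsingleton_one.elim i j <;>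
      simp [langerPair, langerQ, mul_apply, mul_comm]
  | succ m ih =>
    simp only [langerPair, reindex_apply, submatrix_mul_equiv]
    rw [fromBlocks_smul_one_mul_fromBlocks _ _ ih.1 ih.2,
      fromBlocks_smul_one_mul_fromBlocks _ _ ih.2 ih.1, ← langerQ_succ]
    simp only [submatrix_smul, Pi.smul_apply, submatrix_one_equiv, and_self]
end

section
/- Let R be a commutative ring, let φ, ψ be r × r matrices over R and let f, a, b ∈ R satisfy φ·ψ = ψ·φ = f·I_r. Then the block matrices Φ = [[φ, a·I_r],[b·I_r, −ψ]] and Ψ = [[ψ, a·I_r],[b·I_r, −φ]] of size 2r satisfy Φ·Ψ = Ψ·Φ = (f + a·b)·I_{2r}. -/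
open Matrix

/-- One of the two products in the inductive step; the other follows by swapping `φ` and `ψ`. -/
theorem fromBlocks_mul_fromBlocks_neg_eq_smul_one {R n : Type*} [CommRing R] [Fintype n]
    [DecidableEq n] {φ ψ : Matrix n n R} {f : R} (a b : R)
    (h1 : φ * ψ = f • (1 : Matrix n n R)) (h2 : ψ * φ = f • (1 : Matrix n n R)) :
    fromBlocks φ (a • 1) (b • 1) (-ψ) * fromBlocks ψ (a • 1) (b • 1) (-φ) =
      (f + a * b) • (1 : Matrix (n ⊕ n) (n ⊕ n) R) := by
  rw [fromBlocks_multiply, ← fromBlocks_one, fromBlocks_smul]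
  congr 1
  · simp [h1, add_smul, smul_smul, mul_comm]
  · simp
  · simp
  · simp [h2, add_smul, smul_smul, add_comm]

/-- Let `R` be a commutative ring, let `φ, ψ` be `r × r` matrices over `R` and
let `f, a, b ∈ R` satisfy `φ·ψ = ψ·φ = f·I_r`. Then the block matrices
`Φ = [[φ, a·I],[b·I, −ψ]]` and `Ψ = [[ψ, a·I],[b·I, −φ]]` of size `2r` satisfy
`Φ·Ψ = Ψ·Φ = (f + a·b)·I_{2r}`. -/
theorem matrix_factorization_inductive_step {R : Type*} [CommRing R] {r : ℕ}
    (φ ψ : Matrix (Fin r) (Fin r) R) (f a b : R)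
    (h1 : φ * ψ = f • (1 : Matrix (Fin r) (Fin r) R))
    (h2 : ψ * φ = f • (1 : Matrix (Fin r) (Fin r) R)) :
    Matrix.fromBlocks φ (a • (1 : Matrix (Fin r) (Fin r) R))
        (b • (1 : Matrix (Fin r) (Fin r) R)) (-ψ) *
      Matrix.fromBlocks ψ (a • (1 : Matrix (Fin r) (Fin r) R))
        (b • (1 : Matrix (Fin r) (Fin r) R)) (-φ) =
      (f + a * b) • (1 : Matrix (Fin r ⊕ Fin r) (Fin r ⊕ Fin r) R) ∧
    Matrix.fromBlocks ψ (a • (1 : Matrix (Fin r) (Fin r) R))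
        (b • (1 : Matrix (Fin r) (Fin r) R)) (-φ) *
      Matrix.fromBlocks φ (a • (1 : Matrix (Fin r) (Fin r) R))
        (b • (1 : Matrix (Fin r) (Fin r) R)) (-ψ) =
      (f + a * b) • (1 : Matrix (Fin r ⊕ Fin r) (Fin r ⊕ Fin r) R) := by
  exact ⟨fromBlocks_mul_fromBlocks_neg_eq_smul_one a b h1 h2,
    fromBlocks_mul_fromBlocks_neg_eq_smul_one a b h2 h1⟩
end

section
/- For every natural number m, applying the involution α entrywise to Langer's matrix φ_m and then transposing yields ψ_m, and symmetrically for ψ_m: that is, (α(φ_m))^T = ψ_m and (α(ψ_m))^T = φ_m, where α(M) denotes the matrix obtained by applying α to each entry of M. -/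
open MvPolynomial Matrix

/-- The function on variable indices swapping `x_{2i+1}` with `x_{2i+2}` for every `i`
(in the `0`-indexed convention, swapping `X (2i)` with `X (2i+1)`). -/
def swapVar : ℕ → ℕ := fun n => if n % 2 = 0 then n + 1 else n - 1

/-- The `K`-algebra involution `α` swapping `x_{2i+1}` with `x_{2i+2}` for every `i`. -/
noncomputable def swapInvolution (K : Type*) [Field K] :
    MvPolynomial ℕ K →ₐ[K] MvPolynomial ℕ K :=
  MvPolynomial.rename swapVar

theorem swapInvolution_X_even (K : Type*) [Field K] (n : ℕ) :
    swapInvolution K (X (2 * n)) = X (2 * n + 1) := by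
  simp [swapInvolution, swapVar]

theorem swapInvolution_X_odd (K : Type*) [Field K] (n : ℕ) :
    swapInvolution K (X (2 * n + 1)) = X (2 * n) := by
  simp [swapInvolution, swapVar, Nat.add_mod]

/-- Applying `α` and transposing a block matrix with scalar off-diagonal blocks, where `α` swaps
the two scalars. -/
theorem transpose_map_reindex_fromBlocks {R n k F : Type*} [CommRing R] [DecidableEq n]
    [FunLike F R R] [RingHomClass F R R] (α : F) (e : n ⊕ n ≃ k) {x y : R}
    (hx : α x = y) (hy : α y = x) {A B A' B' : Matrix n n R}
    (hA : (A.map α)ᵀ = A') (hB : (B.map α)ᵀ = B') :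
    ((reindex e e (fromBlocks A (x • 1) (y • 1) (-B))).map α)ᵀ =
      reindex e e (fromBlocks A' (x • 1) (y • 1) (-B')) := by
  subst hA hB
  ext i j
  simp only [transpose_apply, map_apply, reindex_apply, submatrix_apply]
  rcases e.symm i with i | i <;> rcases e.symm j with j | j <;>
    simp [Matrix.one_apply, apply_ite α, hx, hy, eq_comm]

/-- For every natural number `m`, applying the involution `α` (which swaps
`x_{2i+1}` with `x_{2i+2}`) entrywise to Langer's matrix `φ_m` and then transposing yields
`ψ_m`, and symmetrically for `ψ_m`: `(α(φ_m))ᵀ = ψ_m` and `(α(ψ_m))ᵀ = φ_m`. -/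
theorem langer_matrices_swap_transpose (K : Type*) [Field K] (m : ℕ) :
    ((langerPair K m).1.map (swapInvolution K))ᵀ = (langerPair K m).2 ∧
    ((langerPair K m).2.map (swapInvolution K))ᵀ = (langerPair K m).1 := by
  induction m with
  | zero =>
    constructor <;> ext i j : 1
    · exact swapInvolution_X_even K 0
    · exact swapInvolution_X_odd K 0
  | succ m ih =>
    have hx : swapInvolution K (X (2 * m + 2)) = X (2 * m + 3) := swapInvolution_X_even K (m + 1)
    have hy : swapInvolution K (X (2 * m + 3)) = X (2 * m + 2) := swapInvolution_X_odd K (m + 1)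
    exact ⟨transpose_map_reindex_fromBlocks _ _ hx hy ih.1 ih.2,
      transpose_map_reindex_fromBlocks _ _ hx hy ih.2 ih.1⟩
end
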